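/- The nested session type D characterizes the Dyck language with end-marker: consider the signature with definitions T[x] = ⊕{L : T[T[x]], R : x} and D = ⊕{L : T[D], $ : 1}, its internal renaming Σ', and the grammar fog(Σ') with rule set S. For every word w over the alphabet {L, R}, the action sequence obtained from w (mapping L to ⊕L and R to ⊕R) followed by ⊕$ belongs to trace_S(⟦D⟧) if and only if w is a balanced Dyck word, i.e., w contains equally many L's and R's and every prefix of w contains at least as many L's as R's. -/

import Mathlib

/-- Labels for internal/external choice. -/
abbrev Label := Nat
/-- Type variables. -/
abbrev TVar := Nat
/-- Defined type names. -/
abbrev TName := Nat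

/-- Session types: internal choice, external choice, tensor, lolli, 1,
type variables, and applications `V[B₁,…,Bₙ]` of defined type names
(represented by an arity `n` together with a function giving the arguments). -/
inductive STy : Type where
  | ichoice : List Label → (Label → STy) → STy
  | echoice : List Label → (Label → STy) → STy
  | tensor  : STy → STy → STy
  | lolli   : STy → STy → STy
  | one     : STy
  | var     : TVar → STy
  | app     : TName → (n : Nat) → (Nat → STy) → STy

namespace STy

/-- Capture-free substitution of types for type variables. -/
def subst (σ : TVar → STy) : STy → STy
  | ichoice L f => ichoice L (fun l => (f l).subst σ)
  | echoice L f => echoice L (fun l => (f l).subst σ)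
  | tensor A B  => tensor (A.subst σ) (B.subst σ)
  | lolli A B   => lolli (A.subst σ) (B.subst σ)
  | one         => one
  | var a       => σ a
  | app V n f   => app V n (fun i => (f i).subst σ)

/-- Free type variables. -/
def fv : STy → Set TVar
  | ichoice L f => {a | ∃ l ∈ L, a ∈ (f l).fv}
  | echoice L f => {a | ∃ l ∈ L, a ∈ (f l).fv}
  | tensor A B  => A.fv ∪ B.fv
  | lolli A B   => A.fv ∪ B.fv
  | one         => ∅
  | var a       => {a}
  | app _ n f   => {a | ∃ i < n, a ∈ (f i).fv}

/-- A type is closed if it has no free type variables. -/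
def closed (A : STy) : Prop := A.fv = ∅

/-- Defined type names occurring in a type. -/
def names : STy → Set TName
  | ichoice L f => {V | ∃ l ∈ L, V ∈ (f l).names}
  | echoice L f => {V | ∃ l ∈ L, V ∈ (f l).names}
  | tensor A B  => A.names ∪ B.names
  | lolli A B   => A.names ∪ B.names
  | one         => ∅
  | var _       => ∅
  | app V n f   => insert V {W | ∃ i < n, W ∈ (f i).names}

/-- Labels occurring in a type. -/
def labels : STy → Set Label
  | ichoice L f => {l | l ∈ L} ∪ {l | ∃ l' ∈ L, l ∈ (f l').labels}
  | echoice L f => {l | l ∈ L} ∪ {l | ∃ l' ∈ L, l ∈ (f l').labels}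
  | tensor A B  => A.labels ∪ B.labels
  | lolli A B   => A.labels ∪ B.labels
  | one         => ∅
  | var _       => ∅
  | app _ n f   => {l | ∃ i < n, l ∈ (f i).labels}

/-- A type is a type-name application. -/
def isApp : STy → Prop
  | app _ _ _ => True
  | _ => False

end STy

/-- A signature: a partial map from type names to (arity, body) definitions
`V[α₀,…,α_{n-1}] = A` (at most one definition per name). -/
abbrev Sig := TName → Option (Nat × STy)

/-- Domain of a signature. -/
def Sig.dom (Sg : Sig) : Set TName := {V | Sg V ≠ none}

/-- A signature is contractive: no definition body is itself a type name
application. -/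
def Contractive (Sg : Sig) : Prop :=
  ∀ V n A, Sg V = some (n, A) → ¬ A.isApp

/-- Unfolding: `unfold (V[B̄]) = A[B̄/ᾱ]` when `V[ᾱ] = A ∈ Σ`, and
`unfold A = A` otherwise. -/
def unfoldT (Sg : Sig) : STy → STy
  | .app V n f =>
      match Sg V with
      | some (_, A) => A.subst f
      | none        => .app V n f
  | A => A

/-- A relation on (closed) session types is a type bisimulation. -/
def IsBisim (Sg : Sig) (R : STy → STy → Prop) : Prop :=
  ∀ A B, R A B →
    (∀ L f, unfoldT Sg A = .ichoice L f →
      ∃ g, unfoldT Sg B = .ichoice L g ∧ ∀ l ∈ L, R (f l) (g l)) ∧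
    (∀ L f, unfoldT Sg A = .echoice L f →
      ∃ g, unfoldT Sg B = .echoice L g ∧ ∀ l ∈ L, R (f l) (g l)) ∧
    (∀ A1 A2, unfoldT Sg A = .tensor A1 A2 →
      ∃ B1 B2, unfoldT Sg B = .tensor B1 B2 ∧ R A1 B1 ∧ R A2 B2) ∧
    (∀ A1 A2, unfoldT Sg A = .lolli A1 A2 →
      ∃ B1 B2, unfoldT Sg B = .lolli B1 B2 ∧ R A1 B1 ∧ R A2 B2) ∧
    (unfoldT Sg A = .one → unfoldT Sg B = .one)

/-- Type equality `A ≡_Σ B` of closed types: some type bisimulation (on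
closed types) relates `A` and `B`. -/
def TypeEq (Sg : Sig) (A B : STy) : Prop :=
  ∃ R : STy → STy → Prop,
    IsBisim Sg R ∧ (∀ X Y, R X Y → X.closed ∧ Y.closed) ∧ R A B

/-- Open type equality `∀𝒱. A ≡_Σ B`: equality of all closed instances. -/
def EqForall (Sg : Sig) (Vs : Set TVar) (A B : STy) : Prop :=
  ∀ σ : TVar → STy, (∀ a ∈ Vs, (σ a).closed) →
    TypeEq Sg (A.subst σ) (B.subst σ)
/-- First-order grammar terms over ranked non-terminals (type names),
a nullary non-terminal `⊥`, and variables. -/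
inductive GTerm : Type where
  | bot : GTerm
  | var : Nat → GTerm
  | app : TName → (n : Nat) → (Nat → GTerm) → GTerm

/-- Substitution of terms for variables in a grammar term. -/
def GTerm.subst (σ : Nat → GTerm) : GTerm → GTerm
  | .bot => .bot
  | .var i => σ i
  | .app X n f => .app X n (fun i => (f i).subst σ)

/-- Grammar actions: `⊕ℓ`, `&ℓ`, `⊗₁/⊗₂`, `⊸₁/⊸₂`. -/
inductive Act : Type where
  | ich : Label → Act
  | ech : Label → Act
  | tens : Bool → Act
  | lol : Bool → Act
deriving DecidableEq

/-- A production rule `X ᾱ --a--> E`: non-terminal, arity, action, body. -/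
abbrev GRule := TName × Nat × Act × GTerm

/-- A set of production rules. -/
abbrev GRules := Set GRule

/-- One rewriting step of closed terms: `T --a--> T'`. -/
def GStep (S : GRules) (T : GTerm) (a : Act) (T' : GTerm) : Prop :=
  ∃ X n f E, T = .app X n f ∧ (X, n, a, E) ∈ S ∧ T' = E.subst f

/-- Multi-step rewriting along a word of actions: `T --w--> T'`. -/
inductive GSteps (S : GRules) : GTerm → List Act → GTerm → Prop where
  | refl (T) : GSteps S T [] T
  | step {T a T' w T''} : GStep S T a T' → GSteps S T' w T'' →
      GSteps S T (a :: w) T''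

/-- The trace of a term: all words along which it can rewrite. -/
def traceS (S : GRules) (T : GTerm) : Set (List Act) :=
  {w | ∃ T', GSteps S T w T'}

/-- Trace equivalence `T ∼_S T'`. -/
def TraceEquiv (S : GRules) (T T' : GTerm) : Prop :=
  traceS S T = traceS S T'

/-- The translation `⟦·⟧` from (atomic) session types to grammar terms:
`⟦1⟧ = ⊥`, `⟦α⟧ = α`, `⟦V[B̄]⟧ = V ⟦B̄⟧` (structural types are not in its
intended domain). -/
def embed : STy → GTerm
  | .one => .bot
  | .var a => .var a
  | .app V n f => .app V n (fun i => embed (f i))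
  | _ => .bot

/-- A type is atomic (in the domain of `⟦·⟧`): `1`, a variable, or a type
name application. -/
def Atomic : STy → Prop
  | .one => True
  | .var _ => True
  | .app _ _ _ => True
  | _ => False

/-- A signature is internally renamed: in every definition, the immediate
subexpressions of the body are `1`, a variable, or a type name application. -/
def Renamed (Sg : Sig) : Prop :=
  ∀ V n A, Sg V = some (n, A) →
    (∀ L f, A = .ichoice L f → ∀ l ∈ L, Atomic (f l)) ∧
    (∀ L f, A = .echoice L f → ∀ l ∈ L, Atomic (f l)) ∧
    (∀ A1 A2, A = .tensor A1 A2 → Atomic A1 ∧ Atomic A2) ∧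
    (∀ A1 A2, A = .lolli A1 A2 → Atomic A1 ∧ Atomic A2)

/-- The rule translation `τ`: each definition contributes one rule per
possible action, with the corresponding translated continuation. -/
def tau (Sg : Sig) : GRules :=
  {r | ∃ V n A, Sg V = some (n, A) ∧
    ((∃ L f, A = .ichoice L f ∧
        ∃ l ∈ L, r = (V, n, Act.ich l, embed (f l))) ∨
     (∃ L f, A = .echoice L f ∧
        ∃ l ∈ L, r = (V, n, Act.ech l, embed (f l))) ∨
     (∃ A1 A2, A = .tensor A1 A2 ∧
        (r = (V, n, Act.tens false, embed A1) ∨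
         r = (V, n, Act.tens true, embed A2))) ∨
     (∃ A1 A2, A = .lolli A1 A2 ∧
        (r = (V, n, Act.lol false, embed A1) ∨
         r = (V, n, Act.lol true, embed A2))))}
/-! The Dyck signature: type names `T := 0`, `D := 1`; labels `L := 0`,
`R := 1`, `$ := 2`.  Definitions:
`T[x] = ⊕{L : T[T[x]], R : x}` and `D = ⊕{L : T[D], $ : 1}`.
All immediate subexpressions of the bodies are already atomic, so this
signature is its own internal renaming. -/
def SgDyck : Sig := fun V =>
  if V = 0 then
    some (1, .ichoice [0, 1] (fun l =>
      if l = 0 then .app 0 1 (fun _ => .app 0 1 (fun _ => .var 0))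
      else .var 0))
  else if V = 1 then
    some (0, .ichoice [0, 2] (fun l =>
      if l = 0 then .app 0 1 (fun _ => .app 1 0 (fun _ => .one))
      else .one))
  else none

/-- The alphabet `{L, R}` of the Dyck language. -/
inductive DyckSym : Type where
  | L | R
deriving DecidableEq

/-- The action corresponding to a symbol: `L ↦ ⊕L`, `R ↦ ⊕R`. -/
def dyckAct : DyckSym → Act
  | .L => Act.ich 0
  | .R => Act.ich 1

/-- A word is a balanced Dyck word: equally many `L`s and `R`s, and every
prefix has at least as many `L`s as `R`s. -/
def BalancedDyck (w : List DyckSym) : Prop :=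
  w.count DyckSym.L = w.count DyckSym.R ∧
  ∀ p, p <+: w → p.count DyckSym.R ≤ p.count DyckSym.L

/-- The term `T[T[…[D]…]]` with `n` occurrences of `T`. -/
def dyckStack : Nat → GTerm
  | 0 => .app 1 0 (fun _ => .bot)
  | n + 1 => .app 0 1 (fun _ => dyckStack n)

theorem mem_tau_SgDyck (X n : Nat) (a : Act) (E : GTerm) :
    (X, n, a, E) ∈ tau SgDyck ↔
      (X = 0 ∧ n = 1 ∧ a = .ich 0 ∧ E = .app 0 1 (fun _ => .app 0 1 (fun _ => .var 0))) ∨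
      (X = 0 ∧ n = 1 ∧ a = .ich 1 ∧ E = .var 0) ∨
      (X = 1 ∧ n = 0 ∧ a = .ich 0 ∧ E = .app 0 1 (fun _ => .app 1 0 (fun _ => .bot))) ∨
      (X = 1 ∧ n = 0 ∧ a = .ich 2 ∧ E = .bot) := by
  constructor
  · rintro ⟨V, m, A, hV, h⟩
    unfold SgDyck at hV
    split_ifs at hV with h0 h1
    · cases hV
      rcases h with ⟨L, f, hA, l, hl, hr⟩ | ⟨L, f, hA, _⟩ | ⟨_, _, hA, _⟩ | ⟨_, _, hA, _⟩ <;>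
        cases hA
      cases hr
      simp only [List.mem_cons, List.not_mem_nil, or_false] at hl
      rcases hl with rfl | rfl <;> simp [embed, h0]
    · cases hV
      rcases h with ⟨L, f, hA, l, hl, hr⟩ | ⟨L, f, hA, _⟩ | ⟨_, _, hA, _⟩ | ⟨_, _, hA, _⟩ <;>
        cases hA
      cases hr
      simp only [List.mem_cons, List.not_mem_nil, or_false] at hl
      rcases hl with rfl | rfl <;> simp [embed, h1]
  · rintro (⟨rfl, rfl, rfl, rfl⟩ | ⟨rfl, rfl, rfl, rfl⟩ | ⟨rfl, rfl, rfl, rfl⟩ | ⟨rfl, rfl, rfl, rfl⟩)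
    · exact ⟨0, 1, _, rfl, .inl ⟨_, _, rfl, 0, by simp, rfl⟩⟩
    · exact ⟨0, 1, _, rfl, .inl ⟨_, _, rfl, 1, by simp, rfl⟩⟩
    · exact ⟨1, 0, _, rfl, .inl ⟨_, _, rfl, 0, by simp, rfl⟩⟩
    · exact ⟨1, 0, _, rfl, .inl ⟨_, _, rfl, 2, by simp, rfl⟩⟩

theorem gstep_dyckStack_zero (a : Act) (U : GTerm) :
    GStep (tau SgDyck) (dyckStack 0) a U ↔
      (a = .ich 0 ∧ U = dyckStack 1) ∨ (a = .ich 2 ∧ U = .bot) := by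
  constructor
  · rintro ⟨X, n, f, E, hT, hr, rfl⟩
    cases hT
    rw [mem_tau_SgDyck] at hr
    rcases hr with ⟨h, _⟩ | ⟨h, _⟩ | ⟨_, _, rfl, rfl⟩ | ⟨_, _, rfl, rfl⟩
    · cases h
    · cases h
    · exact .inl ⟨rfl, rfl⟩
    · exact .inr ⟨rfl, rfl⟩
  · rintro (⟨rfl, rfl⟩ | ⟨rfl, rfl⟩) <;>
      exact ⟨1, 0, _, _, rfl, (mem_tau_SgDyck _ _ _ _).2 (by simp; rfl), rfl⟩

theorem gstep_dyckStack_succ (n : Nat) (a : Act) (U : GTerm) :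
    GStep (tau SgDyck) (dyckStack (n + 1)) a U ↔
      (a = .ich 0 ∧ U = dyckStack (n + 2)) ∨ (a = .ich 1 ∧ U = dyckStack n) := by
  constructor
  · rintro ⟨X, n, f, E, hT, hr, rfl⟩
    cases hT
    rw [mem_tau_SgDyck] at hr
    rcases hr with ⟨_, _, rfl, rfl⟩ | ⟨_, _, rfl, rfl⟩ | ⟨h, _⟩ | ⟨h, _⟩
    · exact .inl ⟨rfl, rfl⟩
    · exact .inr ⟨rfl, rfl⟩
    · cases h
    · cases h
  · rintro (⟨rfl, rfl⟩ | ⟨rfl, rfl⟩) <;>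
      exact ⟨0, 1, _, _, rfl, (mem_tau_SgDyck _ _ _ _).2 (by simp; rfl), rfl⟩

theorem cons_mem_traceS (S : GRules) (T : GTerm) (a : Act) (w : List Act) :
    a :: w ∈ traceS S T ↔ ∃ U, GStep S T a U ∧ w ∈ traceS S U := by
  constructor
  · rintro ⟨T', h⟩
    cases h with
    | step h h' => exact ⟨_, h, _, h'⟩
  · rintro ⟨U, h, T', h'⟩
    exact ⟨T', .step h h'⟩

theorem nil_mem_traceS (S : GRules) (T : GTerm) : [] ∈ traceS S T :=
  ⟨T, .refl T⟩

theorem forall_prefix_cons {α : Type*} (P : List α → Prop) (a : α) (w : List α) :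
    (∀ p, p <+: a :: w → P p) ↔ P [] ∧ ∀ p, p <+: w → P (a :: p) := by
  simp only [List.prefix_cons_iff]
  constructor
  · exact fun h => ⟨h [] (.inl rfl), fun p hp => h _ (.inr ⟨p, rfl, hp⟩)⟩
  · rintro ⟨h, h'⟩ p (rfl | ⟨t, rfl, ht⟩)
    · exact h
    · exact h' t ht

theorem mem_traceS_dyckStack (w : List DyckSym) (n : Nat) :
    w.map dyckAct ++ [Act.ich 2] ∈ traceS (tau SgDyck) (dyckStack n) ↔
      n + w.count .L = w.count .R ∧ ∀ p, p <+: w → p.count .R ≤ n + p.count .L := by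
  induction w generalizing n with
  | nil =>
    cases n <;>
      simp [cons_mem_traceS, gstep_dyckStack_zero, gstep_dyckStack_succ, nil_mem_traceS]
  | cons s w ih =>
    rw [forall_prefix_cons, List.map_cons, List.cons_append, cons_mem_traceS]
    cases s <;> cases n <;>
      simp [dyckAct, gstep_dyckStack_zero, gstep_dyckStack_succ, ih]
    · grind
    · grind
    · exact fun _ => ⟨[], List.nil_prefix, by simp⟩
    · grind

/-- **Theorem (Statement 13).** The nested session type `D` characterizes the
Dyck language with end-marker `$`: for every word `w` over `{L, R}`, the
action sequence of `w` followed by `⊕$` belongs to `trace_S(⟦D⟧)` (where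
`S = τ(Σ')` and `Σ'` is the internal renaming of the Dyck signature, here the
signature itself) iff `w` is a balanced Dyck word. -/
theorem dyck_characterization :
    ∀ w : List DyckSym,
      (w.map dyckAct ++ [Act.ich 2]) ∈
          traceS (tau SgDyck) (embed (.app 1 0 (fun _ => .one)))
        ↔ BalancedDyck w := by
  intro w
  have h := mem_traceS_dyckStack w 0
  simp only [Nat.zero_add] at h
  exact h
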